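/- Let A and B be real symmetric n×n matrices, let Q be a rational orthogonal n×n matrix with A = Qᵀ B Q, and let λ be a simple eigenvalue of A (hence of B). If ξ ∈ ℚⁿ is an eigenvector of A for λ and η ∈ ℚⁿ is an eigenvector of B for λ, then η = r·(Qξ) for some rational number r, and consequently the ratio of Euclidean norms ‖η‖/‖ξ‖ is rational. -/

import Mathlib

open Matrix Polynomial

/-- The adjacency matrix over `ℝ` of a simple graph on `Fin n`. -/
noncomputable def adjMat {n : ℕ} (G : SimpleGraph (Fin n)) : Matrix (Fin n) (Fin n) ℝ :=
  letI : DecidableRel G.Adj := Classical.decRel G.Adj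
  G.adjMatrix ℝ

/-- The chromatic index of a simple graph: the chromatic number of its line graph. -/
noncomputable def chromaticIndex {V : Type*} (G : SimpleGraph V) : ℕ∞ :=
  G.lineGraph.chromaticNumber

/-- Two eigenvectors for an eigenvalue which is a simple root of the characteristic polynomial
are proportional. -/
theorem Matrix.exists_smul_eq_of_charpoly_rootMultiplicity_eq_one {K ι : Type*} [Field K]
    [Fintype ι] [DecidableEq ι] {A : Matrix ι ι K} {μ : K}
    (hμ : A.charpoly.rootMultiplicity μ = 1) {v w : ι → K} (hv0 : v ≠ 0)
    (hv : A *ᵥ v = μ • v) (hw : A *ᵥ w = μ • w) : ∃ c : K, c • v = w := by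
  have hle : Module.finrank K (Module.End.eigenspace A.toLin' μ) ≤ 1 := by
    rw [← hμ, ← Matrix.charpoly_toLin']
    exact LinearMap.finrank_eigenspace_le _ _
  have hv' : v ∈ Module.End.eigenspace A.toLin' μ := by
    rwa [Module.End.mem_eigenspace_iff, Matrix.toLin'_apply]
  have hw' : w ∈ Module.End.eigenspace A.toLin' μ := by
    rwa [Module.End.mem_eigenspace_iff, Matrix.toLin'_apply]
  obtain ⟨u, hu⟩ := finrank_le_one_iff.mp hle
  obtain ⟨a, ha⟩ := hu ⟨v, hv'⟩
  obtain ⟨b, hb⟩ := hu ⟨w, hw'⟩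
  replace ha : a • (u : ι → K) = v := congrArg Subtype.val ha
  replace hb : b • (u : ι → K) = w := congrArg Subtype.val hb
  have ha0 : a ≠ 0 := by
    rintro rfl
    exact hv0 (by rw [← ha, zero_smul])
  exact ⟨b / a, by rw [← ha, ← hb, smul_smul, div_mul_cancel₀ b ha0]⟩

/-- A matrix with orthonormal columns preserves the dot product. -/
theorem Matrix.mulVec_dotProduct_mulVec_of_transpose_mul_self {R m n : Type*} [CommRing R]
    [Fintype m] [Fintype n] [DecidableEq n] {Q : Matrix m n R} (hQ : Qᵀ * Q = 1) (v w : n → R) :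
    (Q *ᵥ v) ⬝ᵥ (Q *ᵥ w) = v ⬝ᵥ w := by
  rw [Matrix.dotProduct_mulVec, ← Matrix.mulVec_transpose, Matrix.mulVec_mulVec, hQ,
    Matrix.one_mulVec]

/-- If `A = Qᵀ B Q` with `Q` rational orthogonal, `lam` is a simple eigenvalue of `A`,
and `ξ`, `η` are rational eigenvectors of `A`, `B` for `lam`, then `η = r • (Q ξ)` for
some rational `r`, and the ratio of Euclidean norms `‖η‖ / ‖ξ‖` is rational. -/
theorem rational_orthogonal_similarity_eigenvector_ratio_rational
    {n : ℕ} (A B Q : Matrix (Fin n) (Fin n) ℝ)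
    (hA : A.IsSymm) (hB : B.IsSymm)
    (hQorth : Qᵀ * Q = 1)
    (hQrat : ∀ i j, ∃ q : ℚ, Q i j = (q : ℝ))
    (hABQ : A = Qᵀ * B * Q)
    (lam : ℝ)
    (hsimple : A.charpoly.rootMultiplicity lam = 1)
    (ξ : Fin n → ℚ) (hξ0 : ξ ≠ 0)
    (hξ : A.mulVec (fun i => (ξ i : ℝ)) = lam • fun i => (ξ i : ℝ))
    (η : Fin n → ℚ) (hη0 : η ≠ 0)
    (hη : B.mulVec (fun i => (η i : ℝ)) = lam • fun i => (η i : ℝ)) :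
    (∃ r : ℚ, (fun i => (η i : ℝ)) = (r : ℝ) • Q.mulVec (fun i => (ξ i : ℝ))) ∧
    (∃ s : ℚ, Real.sqrt (∑ i, (η i : ℝ) ^ 2) / Real.sqrt (∑ i, (ξ i : ℝ) ^ 2) = (s : ℝ)) := by
  have hQorth' : Q * Qᵀ = 1 := mul_eq_one_comm.mp hQorth
  set x : Fin n → ℝ := fun i => (ξ i : ℝ) with hx
  set y : Fin n → ℝ := fun i => (η i : ℝ) with hy
  obtain ⟨j, hj⟩ := Function.ne_iff.mp hξ0
  have hxj : x j ≠ 0 := Rat.cast_ne_zero.mpr hj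
  have hx0 : x ≠ 0 := fun h => hxj (congrFun h j)
  have hv : A *ᵥ (Qᵀ *ᵥ y) = lam • (Qᵀ *ᵥ y) := by
    rw [hABQ, Matrix.mulVec_mulVec, Matrix.mul_assoc, hQorth', Matrix.mul_one,
      ← Matrix.mulVec_mulVec, hη, Matrix.mulVec_smul]
  obtain ⟨c, hc⟩ :=
    Matrix.exists_smul_eq_of_charpoly_rootMultiplicity_eq_one hsimple hx0 hξ hv
  have hyc : y = c • Q *ᵥ x := by
    rw [← Matrix.mulVec_smul, hc, Matrix.mulVec_mulVec, hQorth', Matrix.one_mulVec]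
  choose q hq using hQrat
  have hcr : c = (((∑ i, q i j * η i) / ξ j : ℚ) : ℝ) := by
    have h : c * x j = ∑ i, Q i j * y i := congrFun hc j
    rw [eq_div_of_mul_eq hxj h]
    simp [hq, hx, hy]
  refine ⟨⟨_, hcr ▸ hyc⟩, |(∑ i, q i j * η i) / ξ j|, ?_⟩
  rw [Rat.cast_abs, ← hcr]
  have hnorm : ∑ i, (η i : ℝ) ^ 2 = c ^ 2 * ∑ i, (ξ i : ℝ) ^ 2 := by
    have h : y ⬝ᵥ y = c ^ 2 * (x ⬝ᵥ x) := by
      rw [hyc, smul_dotProduct, dotProduct_smul,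
        Matrix.mulVec_dotProduct_mulVec_of_transpose_mul_self hQorth, smul_eq_mul, smul_eq_mul,
        ← mul_assoc, sq]
    simpa only [dotProduct, ← sq] using h
  have hpos : 0 < ∑ i, (ξ i : ℝ) ^ 2 :=
    Finset.sum_pos' (fun i _ => sq_nonneg _) ⟨j, Finset.mem_univ j, sq_pos_of_ne_zero hxj⟩
  rw [hnorm, Real.sqrt_mul (sq_nonneg c), Real.sqrt_sq_eq_abs,
    mul_div_cancel_right₀ _ (Real.sqrt_pos.mpr hpos).ne']
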